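/- Let ψ be a flow on a metric space (X,d). Then every Lipschitz continuous Lyapunov function for ψ is constant if and only if for every x, y ∈ X and every ε > 0 there exists a strong (ε,0)-chain from x to y. -/

import Mathlib

/-- A (continuous) flow on a metric space. -/
def IsFlow {X : Type*} [MetricSpace X] (ψ : ℝ → X → X) : Prop :=
  Continuous (fun p : ℝ × X => ψ p.1 p.2) ∧ (∀ x, ψ 0 x = x) ∧
    ∀ t s x, ψ (t + s) x = ψ t (ψ s x)

/-- There is a strong `(ε,T)`-chain from `a` to `b`: a finite sequence
`(x_i, t_i)`, `i = 1, …, n` with `t_i ≥ T`, `x_1 = a`, `x_{n+1} = b`, and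
`∑ d(ψ_{t_i}(x_i), x_{i+1}) < ε`. -/
def HasStrongChain {X : Type*} [MetricSpace X] (ψ : ℝ → X → X) (ε T : ℝ) (a b : X) : Prop :=
  ∃ (n : ℕ) (x : Fin (n + 1) → X) (t : Fin n → ℝ), 0 < n ∧ (∀ i, T ≤ t i) ∧
    x 0 = a ∧ x (Fin.last n) = b ∧
    (∑ i : Fin n, dist (ψ (t i) (x i.castSucc)) (x i.succ)) < ε

/-- A strongly chain recurrent point. -/
def StronglyChainRecurrentPt {X : Type*} [MetricSpace X] (ψ : ℝ → X → X) (x : X) : Prop :=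
  ∀ ε > 0, ∀ T ≥ (0 : ℝ), HasStrongChain ψ ε T x x

/-- A Lyapunov function for the flow `ψ`. -/
def IsLyapunov {X : Type*} [MetricSpace X] (ψ : ℝ → X → X) (h : X → ℝ) : Prop :=
  ∀ t ≥ (0 : ℝ), ∀ x, h (ψ t x) ≤ h x

/-- The neutral set of a Lyapunov function. -/
def NeutralSet {X : Type*} [MetricSpace X] (ψ : ℝ → X → X) (h : X → ℝ) : Set X :=
  {x | ∀ t : ℝ, h (ψ t x) = h x}

/-- A first integral for the flow `ψ`. -/
def IsFirstIntegral {X : Type*} [MetricSpace X] (ψ : ℝ → X → X) (h : X → ℝ) : Prop :=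
  ∀ (t : ℝ) (x : X), h (ψ t x) = h x

/-- `ψ_t` is Lipschitz for every `t ≥ 0`, uniformly for `t` in compact subsets
of `[0, +∞)`. -/
def UniformlyLipschitzTimeMaps {X : Type*} [MetricSpace X] (ψ : ℝ → X → X) : Prop :=
  ∀ T ≥ (0 : ℝ), ∃ C : NNReal, ∀ t ∈ Set.Icc 0 T, LipschitzWith C (ψ t)

/-- The flow `ψ` is strongly chain transitive. -/
def StronglyChainTransitive {X : Type*} [MetricSpace X] (ψ : ℝ → X → X) : Prop :=
  ∀ x y : X, ∀ ε > 0, ∀ T ≥ (0 : ℝ), HasStrongChain ψ ε T x y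

theorem Fin.sum_succ_sub_castSucc {n : ℕ} (f : Fin (n + 1) → ℝ) :
    ∑ i : Fin n, (f i.succ - f i.castSucc) = f (Fin.last n) - f 0 := by
  rw [Finset.sum_sub_distrib]
  linarith [Fin.sum_univ_succ f, Fin.sum_univ_castSucc f]

theorem HasStrongChain.pos {X : Type*} [MetricSpace X] {ψ : ℝ → X → X} {ε T : ℝ} {a b : X}
    (h : HasStrongChain ψ ε T a b) : 0 < ε := by
  obtain ⟨n, x, t, -, -, -, -, hs⟩ := h
  exact lt_of_le_of_lt (Finset.sum_nonneg fun _ _ => dist_nonneg) hs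

theorem hasStrongChain_single {X : Type*} [MetricSpace X] {ψ : ℝ → X → X} {ε T t : ℝ} {a b : X}
    (ht : T ≤ t) (h : dist (ψ t a) b < ε) : HasStrongChain ψ ε T a b :=
  ⟨1, ![a, b], ![t], one_pos, by simpa using ht, rfl, rfl, by simpa using h⟩

theorem HasStrongChain.mono {X : Type*} [MetricSpace X] {ψ : ℝ → X → X} {ε δ T : ℝ} {a b : X}
    (h : HasStrongChain ψ ε T a b) (hε : ε ≤ δ) : HasStrongChain ψ δ T a b := by
  obtain ⟨n, x, t, hn, ht, h0, hl, hs⟩ := h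
  exact ⟨n, x, t, hn, ht, h0, hl, hs.trans_le hε⟩

theorem HasStrongChain.snoc {X : Type*} [MetricSpace X] {ψ : ℝ → X → X} {ε T s : ℝ} {a b : X}
    (h : HasStrongChain ψ ε T a b) (hs : T ≤ s) (c : X) :
    HasStrongChain ψ (ε + dist (ψ s b) c) T a c := by
  obtain ⟨n, x, t, -, ht, rfl, rfl, hsum⟩ := h
  refine ⟨n + 1, Fin.snoc (α := fun _ => X) x c, Fin.snoc (α := fun _ => ℝ) t s,
    n.succ_pos, ?_, ?_, ?_, ?_⟩
  · intro i
    refine Fin.lastCases ?_ (fun j => ?_) i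
    · simpa using hs
    · simpa using ht j
  · exact Fin.snoc_castSucc (α := fun _ => X) c x 0
  · simp
  · rw [Fin.sum_univ_castSucc]
    simpa only [Fin.snoc_castSucc, Fin.snoc_last, Fin.succ_last, Fin.succ_castSucc,
      add_lt_add_iff_right] using hsum

/-- The infimal cost of a strong `(ε,0)`-chain from `a` to `b`. -/
noncomputable def strongChainCost {X : Type*} [MetricSpace X] (ψ : ℝ → X → X) (a b : X) : ℝ :=
  sInf {ε | HasStrongChain ψ ε 0 a b}

theorem bddBelow_hasStrongChain {X : Type*} [MetricSpace X] (ψ : ℝ → X → X) (a b : X) :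
    BddBelow {ε | HasStrongChain ψ ε 0 a b} :=
  ⟨0, fun _ h => h.pos.le⟩

theorem nonempty_hasStrongChain {X : Type*} [MetricSpace X] (ψ : ℝ → X → X) (a b : X) :
    {ε | HasStrongChain ψ ε 0 a b}.Nonempty :=
  ⟨_, hasStrongChain_single le_rfl (lt_add_one (dist (ψ 0 a) b))⟩

theorem strongChainCost_le_add_dist {X : Type*} [MetricSpace X] (ψ : ℝ → X → X) {t : ℝ}
    (ht : 0 ≤ t) (a b c : X) :
    strongChainCost ψ a c ≤ strongChainCost ψ a b + dist (ψ t b) c := by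
  rw [← sub_le_iff_le_add]
  refine le_csInf (nonempty_hasStrongChain ψ a b) fun ε hε => ?_
  rw [sub_le_iff_le_add]
  exact csInf_le (bddBelow_hasStrongChain ψ a c) (hε.snoc ht c)

theorem lipschitzWith_strongChainCost {X : Type*} [MetricSpace X] {ψ : ℝ → X → X}
    (hψ : ∀ x, ψ 0 x = x) (a : X) : LipschitzWith 1 (strongChainCost ψ a) :=
  LipschitzWith.of_le_add fun x y => by
    simpa only [hψ, dist_comm y x] using strongChainCost_le_add_dist ψ le_rfl a y x

theorem isLyapunov_strongChainCost {X : Type*} [MetricSpace X] (ψ : ℝ → X → X) (a : X) :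
    IsLyapunov ψ (strongChainCost ψ a) := fun t ht x => by
  simpa only [dist_self, add_zero] using strongChainCost_le_add_dist ψ ht a x (ψ t x)

theorem strongChainCost_self {X : Type*} [MetricSpace X] {ψ : ℝ → X → X}
    (hψ : ∀ x, ψ 0 x = x) (a : X) : strongChainCost ψ a a ≤ 0 :=
  le_of_forall_pos_le_add fun ε hε => by
    rw [zero_add]
    exact csInf_le (bddBelow_hasStrongChain ψ a a)
      (hasStrongChain_single le_rfl (by rwa [hψ, dist_self]))

theorem IsLyapunov.le_add_of_hasStrongChain {X : Type*} [MetricSpace X] {ψ : ℝ → X → X}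
    {h : X → ℝ} (hh : IsLyapunov ψ h) {K : NNReal} (hK : LipschitzWith K h) {ε : ℝ} {a b : X}
    (hab : HasStrongChain ψ ε 0 a b) : h b ≤ h a + K * ε := by
  obtain ⟨n, x, t, -, ht, rfl, rfl, hs⟩ := hab
  have key : h (x (Fin.last n)) - h (x 0) ≤
      ∑ i : Fin n, K * dist (ψ (t i) (x i.castSucc)) (x i.succ) := by
    rw [← Fin.sum_succ_sub_castSucc fun i => h (x i)]
    refine Finset.sum_le_sum fun i _ => ?_
    have h1 := hh (t i) (ht i) (x i.castSucc)
    have h2 := hK.le_add_mul (x i.succ) (ψ (t i) (x i.castSucc))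
    rw [dist_comm] at h2
    linarith
  rw [← Finset.mul_sum] at key
  have := mul_le_mul_of_nonneg_left hs.le K.coe_nonneg
  linarith

theorem lipschitz_lyapunov_constant_iff_strong_zero_chains {X : Type*} [MetricSpace X]
    (ψ : ℝ → X → X) (hψ : IsFlow ψ) :
    (∀ h : X → ℝ, (∃ K : NNReal, LipschitzWith K h) → IsLyapunov ψ h →
        ∀ x y : X, h x = h y) ↔
      ∀ x y : X, ∀ ε > (0 : ℝ), HasStrongChain ψ ε 0 x y := by
  constructor
  · intro H x y ε hε
    have hcost : strongChainCost ψ x y < ε := by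
      rw [H _ ⟨1, lipschitzWith_strongChainCost hψ.2.1 x⟩ (isLyapunov_strongChainCost ψ x) y x]
      exact (strongChainCost_self hψ.2.1 x).trans_lt hε
    obtain ⟨δ, hδ, hδε⟩ := exists_lt_of_csInf_lt (nonempty_hasStrongChain ψ x y) hcost
    exact HasStrongChain.mono hδ hδε.le
  · rintro H h ⟨K, hK⟩ hh
    have hle (x y : X) : h y ≤ h x := by
      refine le_of_forall_pos_le_add fun ε hε => ?_
      have hK1 : (0 : ℝ) < K + 1 := by positivity
      have hchain := hh.le_add_of_hasStrongChain hK (H x y (ε / (K + 1)) (by positivity))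
      have hKε : (K : ℝ) * (ε / (K + 1)) ≤ ε := by
        rw [← mul_div_assoc, div_le_iff₀ hK1]
        nlinarith
      linarith
    exact fun x y => le_antisymm (hle y x) (hle x y)
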